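/- arXiv:0905.1150 — 2 statements merged into one kernel-verified Lean document; each statement's English description precedes it below -/
import Mathlib

section
/- Let n ≥ 1000 be even. Then for every γ > 0, sup{δ_D : D ∈ M_n(γ), β_D/n ≤ 1/90} ≤ δ¹(22γ, n) + 36 γ / n. -/
open Finset

noncomputable def stdNormalCDF (t : ℝ) : ℝ :=
  (Real.sqrt (2 * Real.pi))⁻¹ * ∫ x in Set.Iic t, Real.exp (-(x ^ 2) / 2)

/-- The set of fixed-point-free involutions of `{1,…,n}`. -/
def fpfInvolutions (n : ℕ) : Finset (Equiv.Perm (Fin n)) :=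
  Finset.univ.filter fun π => π * π = 1 ∧ ∀ i, π i ≠ i

/-- Distribution function of `Y_E = Σ e_{iπ(i)}` for `π` uniform on `Π_n`. -/
noncomputable def cdfYE (n : ℕ) (e : Fin n → Fin n → ℝ) (t : ℝ) : ℝ :=
  (((fpfInvolutions n).filter (fun π => ∑ i, e i (π i) ≤ t)).card : ℝ) /
    ((fpfInvolutions n).card : ℝ)

/-- `δ_E = sup_t |F_E(t) − Φ(t)|`. -/
noncomputable def deltaArr (n : ℕ) (e : Fin n → Fin n → ℝ) : ℝ :=
  ⨆ t : ℝ, |cdfYE n e t - stdNormalCDF t|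

/-- Membership in `M_n(γ)`. -/
def memM (n : ℕ) (γ : ℝ) (e : Fin n → Fin n → ℝ) : Prop :=
  (∀ i j, e i j = e j i) ∧ (∀ i, e i i = 0) ∧ (∀ i, ∑ j, e i j = 0) ∧
  2 * ((n : ℝ) - 2) / (((n : ℝ) - 1) * ((n : ℝ) - 3)) * (∑ i, ∑ j, e i j ^ 2) = 1 ∧
  (∑ i, ∑ j, if i ≠ j then |e i j| ^ 3 else 0) ≤ γ

/-- Membership in `M_n¹(γ)`: additionally all entries are bounded by 1. -/
def memM1 (n : ℕ) (γ : ℝ) (e : Fin n → Fin n → ℝ) : Prop :=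
  memM n γ e ∧ ∀ i j, |e i j| ≤ 1

/-- `δ¹(γ, n) = sup_{E ∈ M_n¹(γ)} δ_E`. -/
noncomputable def delta1 (γ : ℝ) (n : ℕ) : ℝ :=
  ⨆ e : {e : Fin n → Fin n → ℝ // memM1 n γ e}, deltaArr n e.val

lemma exp_neg_sq_integrable : MeasureTheory.Integrable (fun x : ℝ => Real.exp (-(x ^ 2) / 2)) := by
  have h := integrable_exp_neg_mul_sq (b := 1 / 2) (by norm_num)
  refine h.congr (Filter.Eventually.of_forall fun x => ?_)
  simp only
  congr 1
  ring

lemma inv_sqrt_two_pi_le_one : (Real.sqrt (2 * Real.pi))⁻¹ ≤ 1 := by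
  apply inv_le_one_of_one_le₀
  rw [Real.one_le_sqrt]
  linarith [Real.pi_gt_three]

lemma stdNormalCDF_sub (a b : ℝ) : stdNormalCDF b - stdNormalCDF a =
    (Real.sqrt (2 * Real.pi))⁻¹ * ∫ x in a..b, Real.exp (-(x ^ 2) / 2) := by
  unfold stdNormalCDF
  rw [← mul_sub, intervalIntegral.integral_Iic_sub_Iic exp_neg_sq_integrable.integrableOn
    exp_neg_sq_integrable.integrableOn]

/-- If the unnormalised Gaussian density is at most `C` between `a` and `b`, then `Φ` varies
by at most `C |b - a|`. -/
lemma abs_stdNormalCDF_sub_le_of_density_le {a b C : ℝ}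
    (h : ∀ x ∈ Set.uIoc a b, Real.exp (-(x ^ 2) / 2) ≤ C) :
    |stdNormalCDF b - stdNormalCDF a| ≤ C * |b - a| := by
  have h1 : ‖∫ x in a..b, Real.exp (-(x ^ 2) / 2)‖ ≤ C * |b - a| := by
    refine intervalIntegral.norm_integral_le_of_norm_le_const fun x hx => ?_
    rw [Real.norm_of_nonneg (Real.exp_pos _).le]
    exact h x hx
  rw [stdNormalCDF_sub, abs_mul, abs_of_nonneg (by positivity)]
  calc _ ≤ 1 * |∫ x in a..b, Real.exp (-(x ^ 2) / 2)| :=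
        mul_le_mul_of_nonneg_right inv_sqrt_two_pi_le_one (abs_nonneg _)
    _ ≤ _ := by rw [one_mul]; exact h1

lemma abs_stdNormalCDF_sub_le (a b : ℝ) : |stdNormalCDF b - stdNormalCDF a| ≤ |b - a| := by
  have := abs_stdNormalCDF_sub_le_of_density_le (a := a) (b := b) (C := 1) fun x _ =>
    Real.exp_le_one_iff.2 (by nlinarith [sq_nonneg x])
  simpa using this

lemma mul_exp_neg_sq_le_one (y : ℝ) : y * Real.exp (-(y ^ 2) / 2) ≤ 1 := by
  have h : y ≤ Real.exp (y ^ 2 / 2) := by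
    nlinarith [Real.add_one_le_exp (y ^ 2 / 2), sq_nonneg (y - 1)]
  calc y * Real.exp (-(y ^ 2) / 2)
      ≤ Real.exp (y ^ 2 / 2) * Real.exp (-(y ^ 2) / 2) := by gcongr
    _ = 1 := by rw [← Real.exp_add]; ring_nf; simp

lemma abs_stdNormalCDF_sub_mul_le {σ : ℝ} (h0 : 0 < σ) (h1 : σ ≤ 1) (u : ℝ) :
    |stdNormalCDF u - stdNormalCDF (σ * u)| ≤ (1 - σ) / σ := by
  have hb : |stdNormalCDF u - stdNormalCDF (σ * u)| ≤
      Real.exp (-((σ * |u|) ^ 2) / 2) * |u - σ * u| := by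
    refine abs_stdNormalCDF_sub_le_of_density_le fun x hx => ?_
    have hx' : σ * |u| ≤ |x| := by
      rcases le_total 0 u with hu | hu
      · rw [Set.uIoc_of_le (by nlinarith)] at hx
        rw [abs_of_nonneg hu]
        exact hx.1.le.trans (le_abs_self x)
      · rw [Set.uIoc_of_ge (by nlinarith)] at hx
        rw [abs_of_nonpos hu]
        have := neg_le_abs x
        linarith [hx.2]
    have hsq : (σ * |u|) ^ 2 ≤ x ^ 2 := by
      rw [← sq_abs x]
      gcongr
    apply Real.exp_le_exp.2
    linarith
  have hu : |u - σ * u| = (1 - σ) / σ * (σ * |u|) := by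
    rw [show u - σ * u = (1 - σ) * u by ring, abs_mul, abs_of_nonneg (by linarith)]
    field_simp
  rw [hu] at hb
  have h3 : 0 ≤ (1 - σ) / σ := div_nonneg (by linarith) h0.le
  nlinarith [mul_exp_neg_sq_le_one (σ * |u|)]

lemma stdNormalCDF_nonneg (t : ℝ) : 0 ≤ stdNormalCDF t :=
  mul_nonneg (by positivity) (MeasureTheory.integral_nonneg fun x => (Real.exp_pos _).le)

lemma stdNormalCDF_le_one (t : ℝ) : stdNormalCDF t ≤ 1 := by
  have h1 : ∫ x in Set.Iic t, Real.exp (-(x ^ 2) / 2) ≤ ∫ x : ℝ, Real.exp (-(x ^ 2) / 2) :=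
    MeasureTheory.setIntegral_le_integral exp_neg_sq_integrable
      (Filter.Eventually.of_forall fun x => (Real.exp_pos _).le)
  have h2 : ∫ x : ℝ, Real.exp (-(x ^ 2) / 2) = Real.sqrt (2 * Real.pi) := by
    have := integral_gaussian (1 / 2)
    rw [show Real.pi / (1 / 2) = 2 * Real.pi by ring] at this
    rw [← this]
    congr 1
    ext x
    congr 1
    ring
  rw [h2] at h1
  have hpos : 0 < Real.sqrt (2 * Real.pi) := Real.sqrt_pos.2 (by positivity)
  unfold stdNormalCDF
  rw [inv_mul_le_iff₀ hpos]
  linarith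

lemma cdfYE_nonneg (n : ℕ) (e : Fin n → Fin n → ℝ) (t : ℝ) : 0 ≤ cdfYE n e t := by
  unfold cdfYE
  positivity

lemma cdfYE_le_one (n : ℕ) (e : Fin n → Fin n → ℝ) (t : ℝ) : cdfYE n e t ≤ 1 :=
  div_le_one_of_le₀ (by exact_mod_cast card_filter_le _ _) (by positivity)

lemma abs_cdfYE_sub_stdNormalCDF_le_one (n : ℕ) (e : Fin n → Fin n → ℝ) (t : ℝ) :
    |cdfYE n e t - stdNormalCDF t| ≤ 1 := by
  rw [abs_le]
  constructor <;> linarith [cdfYE_nonneg n e t, cdfYE_le_one n e t, stdNormalCDF_nonneg t,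
    stdNormalCDF_le_one t]

lemma abs_cdfYE_sub_stdNormalCDF_le_deltaArr (n : ℕ) (e : Fin n → Fin n → ℝ) (t : ℝ) :
    |cdfYE n e t - stdNormalCDF t| ≤ deltaArr n e :=
  le_ciSup (f := fun t => |cdfYE n e t - stdNormalCDF t|)
    ⟨1, by rintro _ ⟨s, rfl⟩; exact abs_cdfYE_sub_stdNormalCDF_le_one n e s⟩ t

lemma deltaArr_le_delta1 {n : ℕ} {γ : ℝ} {e : Fin n → Fin n → ℝ} (he : memM1 n γ e) :
    deltaArr n e ≤ delta1 γ n :=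
  le_ciSup (f := fun e : {e : Fin n → Fin n → ℝ // memM1 n γ e} => deltaArr n e.val)
    ⟨1, by
      rintro _ ⟨e, rfl⟩
      exact ciSup_le fun t => abs_cdfYE_sub_stdNormalCDF_le_one n e.val t⟩ ⟨e, he⟩

/-- Conjugation by a transposition shows that the partner of `i` is equidistributed. -/
lemma card_fpfInvolutions_apply_eq_le {n : ℕ} {i j k : Fin n} (hj : i ≠ j) (hk : i ≠ k) :
    ((fpfInvolutions n).filter fun π => π i = j).card ≤
      ((fpfInvolutions n).filter fun π => π i = k).card := by
  refine card_le_card_of_injOn (fun π => Equiv.swap j k * π * Equiv.swap j k) ?_ ?_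
  · intro π hπ
    simp only [fpfInvolutions, coe_filter, mem_filter, mem_univ, true_and, Set.mem_ofPred_eq]
      at hπ ⊢
    obtain ⟨⟨h1, h2⟩, h3⟩ := hπ
    refine ⟨⟨?_, fun x hx => ?_⟩, ?_⟩
    · have hs : Equiv.swap j k * Equiv.swap j k = 1 := Equiv.swap_mul_self j k
      calc Equiv.swap j k * π * Equiv.swap j k * (Equiv.swap j k * π * Equiv.swap j k)
          = Equiv.swap j k * π * (Equiv.swap j k * Equiv.swap j k) * π * Equiv.swap j k := by
            group
        _ = Equiv.swap j k * (π * π) * Equiv.swap j k := by rw [hs]; group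
        _ = 1 := by rw [h1, mul_one, hs]
    · apply h2 (Equiv.swap j k x)
      have := congrArg (Equiv.swap j k) hx
      simpa [Equiv.Perm.mul_apply] using this
    · simp [Equiv.Perm.mul_apply, Equiv.swap_apply_of_ne_of_ne hj hk, h3]
  · intro π _ ρ _ h
    simpa using h

lemma card_fpfInvolutions_apply_eq {n : ℕ} {i j : Fin n} (hij : i ≠ j) :
    ((n : ℝ) - 1) * ((fpfInvolutions n).filter fun π => π i = j).card =
      (fpfInvolutions n).card := by
  have h1 : (fpfInvolutions n).card =
      ∑ k ∈ univ.erase i, ((fpfInvolutions n).filter fun π => π i = k).card := by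
    refine card_eq_sum_card_fiberwise fun π hπ => ?_
    simp only [fpfInvolutions, coe_filter, mem_univ, true_and, Set.mem_ofPred_eq] at hπ
    simpa using hπ.2 i
  have h2 : ∀ k ∈ univ.erase i, ((fpfInvolutions n).filter fun π => π i = k).card =
      ((fpfInvolutions n).filter fun π => π i = j).card := fun k hk =>
    le_antisymm (card_fpfInvolutions_apply_eq_le (ne_of_mem_erase hk).symm hij)
      (card_fpfInvolutions_apply_eq_le hij (ne_of_mem_erase hk).symm)
  rw [sum_congr rfl h2, sum_const, card_erase_of_mem (mem_univ i), card_univ, Fintype.card_fin,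
    smul_eq_mul] at h1
  have hn : 1 ≤ n := i.pos
  rw [h1]
  push_cast [hn]
  ring

lemma abs_cdfYE_sub_le {n : ℕ} (hn : 2 ≤ n) (d a : Fin n → Fin n → ℝ)
    (hd : ∀ i, a i i = d i i) (t : ℝ) :
    |cdfYE n d t - cdfYE n a t| ≤
      ((univ : Finset (Fin n × Fin n)).filter fun p => a p.1 p.2 ≠ d p.1 p.2).card /
        ((n : ℝ) - 1) := by
  set L := (univ : Finset (Fin n × Fin n)).filter fun p => a p.1 p.2 ≠ d p.1 p.2 with hL
  set bad := (fpfInvolutions n).filter fun π => ∃ i, a i (π i) ≠ d i (π i) with hbad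
  have hn' : (0 : ℝ) < n - 1 := by
    have : (2 : ℝ) ≤ n := by exact_mod_cast hn
    linarith
  have key : ∀ u v : Fin n → Fin n → ℝ, (∀ i j, (u i j ≠ v i j) → a i j ≠ d i j) →
      (((fpfInvolutions n).filter (fun π => ∑ i, u i (π i) ≤ t)).card : ℝ) ≤
      ((fpfInvolutions n).filter (fun π => ∑ i, v i (π i) ≤ t)).card + bad.card := by
    intro u v huv
    have : (fpfInvolutions n).filter (fun π => ∑ i, u i (π i) ≤ t) ⊆
        (fpfInvolutions n).filter (fun π => ∑ i, v i (π i) ≤ t) ∪ bad := by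
      intro π hπ
      rw [mem_filter] at hπ
      rw [mem_union, mem_filter, hbad, mem_filter]
      by_cases h : ∃ i, a i (π i) ≠ d i (π i)
      · exact Or.inr ⟨hπ.1, h⟩
      · refine Or.inl ⟨hπ.1, ?_⟩
        have : ∀ i, u i (π i) = v i (π i) := fun i => by
          by_contra hne
          exact h ⟨i, huv _ _ hne⟩
        simpa only [this] using hπ.2
    exact_mod_cast (card_le_card this).trans (card_union_le _ _)
  have hcard : ((n : ℝ) - 1) * bad.card ≤ L.card * (fpfInvolutions n).card := by
    have hsub : bad ⊆ L.biUnion fun p => (fpfInvolutions n).filter fun π => π p.1 = p.2 := by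
      intro π hπ
      rw [hbad, mem_filter] at hπ
      obtain ⟨h1, i, hi⟩ := hπ
      rw [mem_biUnion]
      exact ⟨(i, π i), by simpa [hL] using hi, by simp [h1]⟩
    have h1 : (bad.card : ℝ) ≤
        ∑ p ∈ L, (((fpfInvolutions n).filter fun π => π p.1 = p.2).card : ℝ) := by
      exact_mod_cast (card_le_card hsub).trans card_biUnion_le
    calc ((n : ℝ) - 1) * bad.card
        ≤ ((n : ℝ) - 1) *
          ∑ p ∈ L, (((fpfInvolutions n).filter fun π => π p.1 = p.2).card : ℝ) := by gcongr
      _ = ∑ p ∈ L, ((fpfInvolutions n).card : ℝ) := by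
          rw [mul_sum]
          refine sum_congr rfl fun p hp => card_fpfInvolutions_apply_eq fun h => ?_
          rw [hL, mem_filter] at hp
          apply hp.2
          rw [← h, hd]
      _ = _ := by simp
  have hdiv : (bad.card : ℝ) / (fpfInvolutions n).card ≤ L.card / ((n : ℝ) - 1) := by
    rcases Nat.eq_zero_or_pos (fpfInvolutions n).card with h0 | h0
    · rw [h0]
      simp only [Nat.cast_zero, div_zero]
      positivity
    · rw [div_le_div_iff₀ (by exact_mod_cast h0) hn']
      linarith
  refine le_trans ?_ hdiv
  unfold cdfYE
  rw [← sub_div, abs_div, Nat.abs_cast]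
  gcongr
  rw [abs_le]
  constructor
  · linarith [key a d fun i j h => h]
  · linarith [key d a fun i j h => h.symm]

/-- The array `a` with its entries larger than `1/2` in absolute value replaced by `0`. -/
noncomputable def truncHalf {n : ℕ} (a : Fin n → Fin n → ℝ) (i j : Fin n) : ℝ :=
  if |a i j| ≤ 1 / 2 then a i j else 0

/-- Off-diagonal double centring: all row sums of the result vanish. -/
noncomputable def center {n : ℕ} (a : Fin n → Fin n → ℝ) (i j : Fin n) : ℝ :=
  if i = j then 0 else
    a i j - ((∑ k, a i k) + ∑ k, a j k) / ((n : ℝ) - 2) +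
      (∑ k, ∑ l, a k l) / (((n : ℝ) - 1) * ((n : ℝ) - 2))

section center

variable {n : ℕ} {a : Fin n → Fin n → ℝ}

lemma center_self (i : Fin n) : center a i i = 0 := by simp [center]

lemma center_symm (ha : ∀ i j, a i j = a j i) (i j : Fin n) : center a i j = center a j i := by
  unfold center
  by_cases h : i = j
  · simp [h]
  · rw [if_neg h, if_neg (Ne.symm h), ha i j, add_comm (∑ k, a i k)]

lemma sum_center (hn : 3 ≤ n) (h0 : ∀ i, a i i = 0) (i : Fin n) : ∑ j, center a i j = 0 := by
  have hn3 : (3 : ℝ) ≤ n := by exact_mod_cast hn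
  have hn2 : (n : ℝ) - 2 ≠ 0 := by linarith
  have hn1 : (n : ℝ) - 1 ≠ 0 := by linarith
  have h : ∀ j, center a i j = (a i j - ((∑ k, a i k) + ∑ k, a j k) / ((n : ℝ) - 2) +
      (∑ k, ∑ l, a k l) / (((n : ℝ) - 1) * ((n : ℝ) - 2))) -
      if i = j then (-((∑ k, a i k) + ∑ k, a i k) / ((n : ℝ) - 2) +
      (∑ k, ∑ l, a k l) / (((n : ℝ) - 1) * ((n : ℝ) - 2))) else 0 := by
    intro j
    unfold center
    split_ifs with hij
    · subst hij
      rw [h0]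
      ring
    · ring
  simp only [h, sum_sub_distrib, sum_add_distrib, ← sum_div, sum_ite_eq, mem_univ, if_true,
    sum_const, card_univ, Fintype.card_fin, nsmul_eq_mul]
  field_simp
  ring

lemma sum_center_perm (hn : 3 ≤ n) {π : Equiv.Perm (Fin n)} (hπ : ∀ i, π i ≠ i) :
    ∑ i, center a i (π i) = ∑ i, a i (π i) - (∑ k, ∑ l, a k l) / ((n : ℝ) - 1) := by
  have hn3 : (3 : ℝ) ≤ n := by exact_mod_cast hn
  have hn2 : (n : ℝ) - 2 ≠ 0 := by linarith
  have hn1 : (n : ℝ) - 1 ≠ 0 := by linarith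
  have h : ∀ i, center a i (π i) = a i (π i) -
      ((∑ k, a i k) + ∑ k, a (π i) k) / ((n : ℝ) - 2) +
      (∑ k, ∑ l, a k l) / (((n : ℝ) - 1) * ((n : ℝ) - 2)) := fun i => by
    rw [center, if_neg (hπ i).symm]
  have hp : ∑ i, ∑ k, a (π i) k = ∑ i, ∑ k, a i k := Equiv.sum_comp π fun i => ∑ k, a i k
  simp only [h, sum_sub_distrib, sum_add_distrib, ← sum_div, sum_const, card_univ,
    Fintype.card_fin, nsmul_eq_mul, hp]
  field_simp
  ring

lemma sum_center_mul_additive (hn : 3 ≤ n) (hs : ∀ i j, a i j = a j i) (h0 : ∀ i, a i i = 0)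
    (f : Fin n → ℝ) (c : ℝ) : ∑ i, ∑ j, center a i j * (f i + f j + c) = 0 := by
  have h1 : ∑ i, ∑ j, center a i j * (f i + c) = 0 :=
    sum_eq_zero fun i _ => by rw [← sum_mul, sum_center hn h0, zero_mul]
  have h2 : ∑ i, ∑ j, center a i j * f j = 0 := by
    rw [sum_comm]
    refine sum_eq_zero fun i _ => ?_
    simp only [center_symm hs _ i]
    rw [← sum_mul, sum_center hn h0, zero_mul]
  calc ∑ i, ∑ j, center a i j * (f i + f j + c)
      = ∑ i, ∑ j, center a i j * (f i + c) + ∑ i, ∑ j, center a i j * f j := by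
        simp only [← sum_add_distrib]
        exact sum_congr rfl fun i _ => sum_congr rfl fun j _ => by ring
    _ = 0 := by rw [h1, h2, add_zero]

lemma sum_center_sq_eq_sum_mul (hn : 3 ≤ n) (hs : ∀ i j, a i j = a j i) (h0 : ∀ i, a i i = 0) :
    ∑ i, ∑ j, center a i j ^ 2 = ∑ i, ∑ j, a i j * center a i j := by
  have h := sum_center_mul_additive hn hs h0 (fun i => -(∑ k, a i k) / ((n : ℝ) - 2))
    ((∑ k, ∑ l, a k l) / (((n : ℝ) - 1) * ((n : ℝ) - 2)))
  rw [← add_zero (∑ i, ∑ j, a i j * center a i j), ← h]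
  simp only [← sum_add_distrib]
  refine sum_congr rfl fun i _ => sum_congr rfl fun j _ => ?_
  by_cases hij : i = j
  · simp [hij, center_self]
  · rw [center, if_neg hij]
    ring

lemma sum_center_sq_le (hn : 3 ≤ n) (hs : ∀ i j, a i j = a j i) (h0 : ∀ i, a i i = 0) :
    ∑ i, ∑ j, center a i j ^ 2 ≤ ∑ i, ∑ j, a i j ^ 2 := by
  have h1 : 0 ≤ ∑ i, ∑ j, (a i j - center a i j) ^ 2 := by positivity
  have h2 : ∑ i, ∑ j, (a i j - center a i j) ^ 2 = ∑ i, ∑ j, a i j ^ 2 -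
      2 * ∑ i, ∑ j, a i j * center a i j + ∑ i, ∑ j, center a i j ^ 2 := by
    simp only [mul_sum, ← sum_sub_distrib, ← sum_add_distrib]
    exact sum_congr rfl fun i _ => sum_congr rfl fun j _ => by ring
  rw [h2, ← sum_center_sq_eq_sum_mul hn hs h0] at h1
  linarith

lemma le_sum_center_sq (hn : 3 ≤ n) (hs : ∀ i j, a i j = a j i) (h0 : ∀ i, a i i = 0) :
    ∑ i, ∑ j, a i j ^ 2 - 2 * (∑ i, (∑ k, a i k) ^ 2) / ((n : ℝ) - 2) ≤
      ∑ i, ∑ j, center a i j ^ 2 := by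
  have hn3 : (3 : ℝ) ≤ n := by exact_mod_cast hn
  set s := ∑ k, ∑ l, a k l with hsdef
  have h1 : ∑ i, ∑ j, a i j * center a i j = ∑ i, ∑ j, (a i j ^ 2 -
      a i j * (∑ k, a i k) / ((n : ℝ) - 2) - a i j * (∑ k, a j k) / ((n : ℝ) - 2) +
      a i j * (s / (((n : ℝ) - 1) * ((n : ℝ) - 2)))) := by
    refine sum_congr rfl fun i _ => sum_congr rfl fun j _ => ?_
    by_cases hij : i = j
    · simp [hij, h0]
    · rw [center, if_neg hij]
      ring
  have h2 : ∑ i, ∑ j, a i j * (∑ k, a i k) = ∑ i, (∑ k, a i k) ^ 2 :=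
    sum_congr rfl fun i _ => by rw [← sum_mul, sq]
  have h3 : ∑ i, ∑ j, a i j * (∑ k, a j k) = ∑ i, (∑ k, a i k) ^ 2 := by
    rw [sum_comm, ← h2]
    exact sum_congr rfl fun i _ => sum_congr rfl fun j _ => by rw [hs j i]
  rw [sum_center_sq_eq_sum_mul hn hs h0, h1]
  simp only [sum_add_distrib, sum_sub_distrib, ← sum_div, ← sum_mul, h3]
  rw [← hsdef]
  have h4 : 0 ≤ s * (s / (((n : ℝ) - 1) * ((n : ℝ) - 2))) := by
    rw [← mul_div_assoc]
    exact div_nonneg (mul_self_nonneg s) (mul_nonneg (by linarith) (by linarith))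
  have h5 : ∑ i, (∑ j, a i j) * ∑ k, a i k = ∑ i, (∑ k, a i k) ^ 2 :=
    sum_congr rfl fun i _ => (sq _).symm
  rw [h5]
  ring_nf at h4 ⊢
  linarith

/-- The size of the correction made by `center` at the entry `(i, j)`. -/
noncomputable def centerError (a : Fin n → Fin n → ℝ) (i j : Fin n) : ℝ :=
  (|∑ k, a i k| + |∑ k, a j k|) / ((n : ℝ) - 2) +
    |∑ k, ∑ l, a k l| / (((n : ℝ) - 1) * ((n : ℝ) - 2))

lemma centerError_nonneg (hn : 3 ≤ n) (i j : Fin n) : 0 ≤ centerError a i j := by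
  have hn3 : (3 : ℝ) ≤ n := by exact_mod_cast hn
  have h2 : (0 : ℝ) < n - 2 := by linarith
  have h1 : (0 : ℝ) < n - 1 := by linarith
  unfold centerError
  positivity

lemma abs_center_le (hn : 3 ≤ n) (i j : Fin n) :
    |center a i j| ≤ |a i j| + centerError a i j := by
  by_cases hij : i = j
  · rw [hij, center_self, abs_zero]
    exact add_nonneg (abs_nonneg _) (centerError_nonneg hn j j)
  · have hn3 : (3 : ℝ) ≤ n := by exact_mod_cast hn
    have h2 : (0 : ℝ) < n - 2 := by linarith
    have h1 : (0 : ℝ) < n - 1 := by linarith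
    rw [center, if_neg hij, centerError, ← add_assoc]
    refine (abs_add_le _ _).trans (add_le_add ((abs_sub _ _).trans ?_) ?_)
    · rw [abs_div, abs_of_pos h2]
      gcongr
      exact abs_add_le _ _
    · rw [abs_div, abs_of_pos (mul_pos h1 h2)]

lemma sum_centerError : ∑ i, ∑ j, centerError a i j =
    2 * n * (∑ i, |∑ k, a i k|) / ((n : ℝ) - 2) +
      n * n * |∑ k, ∑ l, a k l| / (((n : ℝ) - 1) * ((n : ℝ) - 2)) := by
  unfold centerError
  simp only [sum_add_distrib, ← sum_div, sum_const, card_univ, Fintype.card_fin, nsmul_eq_mul,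
    ← mul_sum]
  ring

end center

lemma add_pow_three_le {x y : ℝ} (hx : 0 ≤ x) (hy : 0 ≤ y) :
    (x + y) ^ 3 ≤ 4 * x ^ 3 + 4 * y ^ 3 := by
  nlinarith [mul_nonneg (add_nonneg hx hy) (sq_nonneg (x - y))]

section truncHalf

variable {n : ℕ} (d : Fin n → Fin n → ℝ) (i j : Fin n)

lemma abs_truncHalf_le : |truncHalf d i j| ≤ |d i j| := by
  unfold truncHalf
  split_ifs <;> simp

lemma abs_truncHalf_le_half : |truncHalf d i j| ≤ 1 / 2 := by
  unfold truncHalf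
  split_ifs with h
  · exact h
  · norm_num

lemma abs_sub_truncHalf_le : |d i j - truncHalf d i j| ≤ 4 * |d i j| ^ 3 := by
  unfold truncHalf
  split_ifs with h
  · simp only [sub_self, abs_zero]
    positivity
  · rw [sub_zero]
    push Not at h
    nlinarith [mul_pos (show 0 < |d i j| by linarith) (show 0 < |d i j| - 1 / 2 by linarith),
      mul_pos (mul_pos (show 0 < |d i j| by linarith) (show 0 < |d i j| by linarith))
        (show 0 < |d i j| - 1 / 2 by linarith)]

lemma sq_sub_truncHalf_sq_le : d i j ^ 2 - truncHalf d i j ^ 2 ≤ 2 * |d i j| ^ 3 := by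
  unfold truncHalf
  split_ifs with h
  · simp only [sub_self]
    positivity
  · push Not at h
    rw [← sq_abs (d i j)]
    nlinarith [mul_pos (mul_pos (show 0 < |d i j| by linarith) (show 0 < |d i j| by linarith))
        (show 0 < |d i j| - 1 / 2 by linarith)]

lemma card_truncHalf_ne_le :
    (((univ : Finset (Fin n × Fin n)).filter fun p => truncHalf d p.1 p.2 ≠ d p.1 p.2).card : ℝ)
      ≤ 8 * ∑ i, ∑ j, |d i j| ^ 3 := by
  rw [card_eq_sum_ones, Nat.cast_sum, ← Fintype.sum_prod_type', mul_sum]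
  rw [sum_filter]
  refine sum_le_sum fun p _ => ?_
  by_cases h : |d p.1 p.2| ≤ 1 / 2
  · have : truncHalf d p.1 p.2 = d p.1 p.2 := if_pos h
    rw [if_neg (not_not.2 this)]
    positivity
  · push Not at h
    have : (1 / 2 : ℝ) ^ 3 ≤ |d p.1 p.2| ^ 3 := by gcongr
    split_ifs
    · norm_num at this ⊢
      linarith
    · positivity

lemma sum_abs_rowSum_truncHalf_le (hd : ∀ i, ∑ j, d i j = 0) :
    ∑ i, |∑ j, truncHalf d i j| ≤ 4 * ∑ i, ∑ j, |d i j| ^ 3 := by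
  rw [mul_sum]
  refine sum_le_sum fun i _ => ?_
  have h : ∑ j, truncHalf d i j = -∑ j, (d i j - truncHalf d i j) := by
    rw [sum_sub_distrib, hd]
    ring
  rw [h, abs_neg, mul_sum]
  exact (abs_sum_le_sum_abs _ _).trans (sum_le_sum fun j _ => abs_sub_truncHalf_le d i j)

lemma sum_sq_sub_sum_truncHalf_sq_le : ∑ i, ∑ j, d i j ^ 2 - ∑ i, ∑ j, truncHalf d i j ^ 2 ≤
    2 * ∑ i, ∑ j, |d i j| ^ 3 := by
  simp only [mul_sum, ← sum_sub_distrib]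
  exact sum_le_sum fun i _ => sum_le_sum fun j _ => sq_sub_truncHalf_sq_le d i j

end truncHalf

lemma cdfYE_center_div {n : ℕ} (hn : 3 ≤ n) (a : Fin n → Fin n → ℝ) {σ : ℝ} (hσ : 0 < σ)
    (u : ℝ) : cdfYE n (fun i j => center a i j / σ) u =
      cdfYE n a (σ * u + (∑ k, ∑ l, a k l) / ((n : ℝ) - 1)) := by
  unfold cdfYE
  congr 3
  refine filter_congr fun π hπ => ?_
  rw [fpfInvolutions, mem_filter] at hπ
  rw [← sum_div, sum_center_perm hn hπ.2.2, div_le_iff₀ hσ, sub_le_iff_le_add, mul_comm u]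

/-- Distribution functions that agree up to the affine change `t = σ u + μ` and an error `p` are
compared with `Φ`. -/
lemma abs_sub_stdNormalCDF_le_of_affine {F G σ μ u p D : ℝ} (h0 : 0 < σ) (h1 : σ ≤ 1)
    (hFG : |F - G| ≤ p) (hG : |G - stdNormalCDF u| ≤ D) :
    |F - stdNormalCDF (σ * u + μ)| ≤ D + (p + (1 - σ) / σ + |μ|) := by
  have h2 := abs_stdNormalCDF_sub_mul_le h0 h1 u
  have h3 : |stdNormalCDF (σ * u) - stdNormalCDF (σ * u + μ)| ≤ |μ| := by
    have := abs_stdNormalCDF_sub_le (σ * u + μ) (σ * u)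
    rwa [sub_add_cancel_left, abs_neg] at this
  rw [abs_le] at *
  constructor <;> linarith

lemma sum_off_diagonal_eq {n : ℕ} {e : Fin n → Fin n → ℝ} (he : ∀ i, e i i = 0) :
    (∑ i, ∑ j, if i ≠ j then |e i j| ^ 3 else 0) = ∑ i, ∑ j, |e i j| ^ 3 := by
  refine sum_congr rfl fun i _ => sum_congr rfl fun j _ => ?_
  split_ifs with h
  · rfl
  · push Not at h
    simp [h, he]

lemma truncHalf_symm {n : ℕ} {d : Fin n → Fin n → ℝ} (h : ∀ i j, d i j = d j i) (i j : Fin n) :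
    truncHalf d i j = truncHalf d j i := by
  simp only [truncHalf, h i j]

lemma truncHalf_self {n : ℕ} {d : Fin n → Fin n → ℝ} (h : ∀ i, d i i = 0) (i : Fin n) :
    truncHalf d i i = 0 := by
  simp [truncHalf, h]

lemma sum_sq_rowSum_le {n : ℕ} (a : Fin n → Fin n → ℝ) :
    ∑ i, (∑ k, a i k) ^ 2 ≤ (∑ i, |∑ k, a i k|) ^ 2 := by
  rw [sq (∑ i, |∑ k, a i k|), sum_mul]
  refine sum_le_sum fun i hi => ?_
  rw [← sq_abs, sq]
  gcongr
  exact single_le_sum (f := fun i => |∑ k, a i k|) (fun _ _ => abs_nonneg _) hi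

section centeredTruncation

variable {n : ℕ} {d : Fin n → Fin n → ℝ}

lemma sum_centerError_truncHalf_le
    (hn : 1000 ≤ n) (hrow : ∀ i, ∑ j, d i j = 0) :
    ∑ i, ∑ j, centerError (truncHalf d) i j ≤ 13 * ∑ i, ∑ j, |d i j| ^ 3 := by
  have hN : (1000 : ℝ) ≤ n := by exact_mod_cast hn
  have hN2 : (0 : ℝ) < n - 2 := by linarith
  have hN1 : (0 : ℝ) < n - 1 := by linarith
  rw [sum_centerError]
  have hRβ := sum_abs_rowSum_truncHalf_le d hrow
  have hs : |∑ k, ∑ l, truncHalf d k l| ≤ ∑ k, |∑ l, truncHalf d k l| := abs_sum_le_sum_abs _ _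
  have hR0 : 0 ≤ ∑ i, |∑ k, truncHalf d i k| := by positivity
  generalize ∑ i, |∑ k, truncHalf d i k| = R at *
  have h1 : 2 * n * R / ((n : ℝ) - 2) ≤ 201 / 100 * R := by
    rw [div_le_iff₀ hN2]
    nlinarith
  have h2 : n * n * |∑ k, ∑ l, truncHalf d k l| / (((n : ℝ) - 1) * (n - 2)) ≤ 101 / 100 * R := by
    rw [div_le_iff₀ (mul_pos hN1 hN2)]
    have h3 : (n : ℝ) * n ≤ 101 / 100 * ((n - 1) * (n - 2)) := by nlinarith
    calc n * n * |∑ k, ∑ l, truncHalf d k l|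
        ≤ 101 / 100 * (((n : ℝ) - 1) * (n - 2)) * R := by gcongr
      _ = _ := by ring
  linarith

lemma sum_abs_rowSum_truncHalf_div_le
    (hn : 1000 ≤ n) (hrow : ∀ i, ∑ j, d i j = 0)
    (hβ : ∑ i, ∑ j, |d i j| ^ 3 ≤ (n : ℝ) / 90) :
    (∑ i, |∑ k, truncHalf d i k|) / ((n : ℝ) - 2) ≤ 9 / 200 := by
  have hN : (1000 : ℝ) ≤ n := by exact_mod_cast hn
  rw [div_le_iff₀ (by linarith)]
  linarith [sum_abs_rowSum_truncHalf_le d hrow]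

lemma centerError_truncHalf_le
    (hn : 1000 ≤ n) (hrow : ∀ i, ∑ j, d i j = 0)
    (hβ : ∑ i, ∑ j, |d i j| ^ 3 ≤ (n : ℝ) / 90)
    (i j : Fin n) : centerError (truncHalf d) i j ≤ 1 / 10 := by
  have hN : (1000 : ℝ) ≤ n := by exact_mod_cast hn
  have hN2 : (0 : ℝ) < n - 2 := by linarith
  have hR2 := sum_abs_rowSum_truncHalf_div_le hn hrow hβ
  have hs : |∑ k, ∑ l, truncHalf d k l| ≤ ∑ k, |∑ l, truncHalf d k l| := abs_sum_le_sum_abs _ _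
  have hri : ∀ i, |∑ k, truncHalf d i k| ≤ ∑ i, |∑ k, truncHalf d i k| := fun i =>
    single_le_sum (f := fun i => |∑ k, truncHalf d i k|) (fun _ _ => abs_nonneg _) (mem_univ i)
  have hR0 : 0 ≤ ∑ i, |∑ k, truncHalf d i k| := by positivity
  rw [centerError]
  generalize ∑ i, |∑ k, truncHalf d i k| = R at *
  have h1 : (|∑ k, truncHalf d i k| + |∑ k, truncHalf d j k|) / ((n : ℝ) - 2) ≤
      2 * (R / (n - 2)) := by
    rw [← mul_div_assoc]
    gcongr
    linarith [hri i, hri j]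
  have h2 : |∑ k, ∑ l, truncHalf d k l| / (((n : ℝ) - 1) * (n - 2)) ≤
      1 / 999 * (R / (n - 2)) := by
    rw [div_mul_div_comm, one_mul]
    gcongr
    linarith
  linarith

lemma sum_abs_center_truncHalf_pow_three_le
    (hn : 1000 ≤ n) (hrow : ∀ i, ∑ j, d i j = 0)
    (hβ : ∑ i, ∑ j, |d i j| ^ 3 ≤ (n : ℝ) / 90) :
    ∑ i, ∑ j, |center (truncHalf d) i j| ^ 3 ≤ 5 * ∑ i, ∑ j, |d i j| ^ 3 := by
  have h1 : ∑ i, ∑ j, |center (truncHalf d) i j| ^ 3 ≤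
      ∑ i, ∑ j, (4 * |d i j| ^ 3 + 4 / 100 * centerError (truncHalf d) i j) := by
    refine sum_le_sum fun i _ => sum_le_sum fun j _ => ?_
    have hw0 := centerError_nonneg (a := truncHalf d) (by omega) i j
    have hw := centerError_truncHalf_le hn hrow hβ i j
    have h2 : |center (truncHalf d) i j| ≤ |d i j| + centerError (truncHalf d) i j :=
      (abs_center_le (by omega) i j).trans (by linarith [abs_truncHalf_le d i j])
    have h3 : centerError (truncHalf d) i j ^ 3 ≤ 1 / 100 * centerError (truncHalf d) i j := by
      have : centerError (truncHalf d) i j ^ 2 ≤ (1 / 10) ^ 2 := by gcongr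
      nlinarith
    calc |center (truncHalf d) i j| ^ 3 ≤ (|d i j| + centerError (truncHalf d) i j) ^ 3 := by
          gcongr
      _ ≤ _ := add_pow_three_le (abs_nonneg _) hw0
      _ ≤ _ := by linarith
  simp only [sum_add_distrib, ← mul_sum] at h1
  have h0 : 0 ≤ ∑ i, ∑ j, |d i j| ^ 3 := by positivity
  linarith [sum_centerError_truncHalf_le hn hrow]

lemma sum_sq_sub_sum_center_truncHalf_sq_le
    (hn : 1000 ≤ n) (hrow : ∀ i, ∑ j, d i j = 0)
    (hβ : ∑ i, ∑ j, |d i j| ^ 3 ≤ (n : ℝ) / 90)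
    (hsym : ∀ i j, d i j = d j i) (hdiag : ∀ i, d i i = 0) :
    ∑ i, ∑ j, d i j ^ 2 - ∑ i, ∑ j, center (truncHalf d) i j ^ 2 ≤
      12 / 5 * ∑ i, ∑ j, |d i j| ^ 3 := by
  have hN : (1000 : ℝ) ≤ n := by exact_mod_cast hn
  have hN2 : (0 : ℝ) < n - 2 := by linarith
  have h1 := le_sum_center_sq (by omega) (truncHalf_symm hsym) (truncHalf_self hdiag)
  have h2 := sum_sq_sub_sum_truncHalf_sq_le d
  have hR2 := sum_abs_rowSum_truncHalf_div_le hn hrow hβ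
  have hRβ := sum_abs_rowSum_truncHalf_le d hrow
  have hr2 := sum_sq_rowSum_le (truncHalf d)
  have hR0 : 0 ≤ ∑ i, |∑ k, truncHalf d i k| := by positivity
  have hβ0 : 0 ≤ ∑ i, ∑ j, |d i j| ^ 3 := by positivity
  have h3 : 2 * (∑ i, (∑ k, truncHalf d i k) ^ 2) / ((n : ℝ) - 2) ≤
      2 * (9 / 200) * (4 * ∑ i, ∑ j, |d i j| ^ 3) := by
    generalize ∑ i, |∑ k, truncHalf d i k| = R at *
    calc 2 * (∑ i, (∑ k, truncHalf d i k) ^ 2) / ((n : ℝ) - 2) ≤ 2 * R ^ 2 / (n - 2) := by gcongr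
      _ = 2 * (R / (n - 2)) * R := by ring
      _ ≤ _ := by gcongr
  linarith

lemma exists_memM1_center_truncHalf_div
    (hn : 1000 ≤ n) (hrow : ∀ i, ∑ j, d i j = 0)
    (hβ : ∑ i, ∑ j, |d i j| ^ 3 ≤ (n : ℝ) / 90)
    (hsym : ∀ i j, d i j = d j i) (hdiag : ∀ i, d i i = 0)
    {γ : ℝ} (hβγ : ∑ i, ∑ j, |d i j| ^ 3 ≤ γ)
    (hvar : 2 * ((n : ℝ) - 2) / (((n : ℝ) - 1) * ((n : ℝ) - 3)) * (∑ i, ∑ j, d i j ^ 2) = 1) :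
    ∃ σ : ℝ, 0 < σ ∧ σ ≤ 1 ∧ (1 - σ) / σ ≤ 6 * ((∑ i, ∑ j, |d i j| ^ 3) / n) ∧
      memM1 n (22 * γ) fun i j => center (truncHalf d) i j / σ := by
  have hN : (1000 : ℝ) ≤ n := by exact_mod_cast hn
  have hn3 : 3 ≤ n := by omega
  have hasym := truncHalf_symm hsym
  have hadiag := truncHalf_self hdiag
  have hdiff := sum_sq_sub_sum_center_truncHalf_sq_le hn hrow hβ hsym hdiag
  have hle : ∑ i, ∑ j, center (truncHalf d) i j ^ 2 ≤ ∑ i, ∑ j, d i j ^ 2 :=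
    (sum_center_sq_le hn3 hasym hadiag).trans
      (sum_le_sum fun i _ => sum_le_sum fun j _ => sq_le_sq.2 (abs_truncHalf_le d i j))
  have hcube := sum_abs_center_truncHalf_pow_three_le hn hrow hβ
  have hβ0 : 0 ≤ ∑ i, ∑ j, |d i j| ^ 3 := by positivity
  have hw := centerError_truncHalf_le hn hrow hβ
  have hc0 : 0 < 2 * ((n : ℝ) - 2) / (((n : ℝ) - 1) * ((n : ℝ) - 3)) :=
    div_pos (by linarith) (mul_pos (by linarith) (by linarith))
  have hcN : 2 * ((n : ℝ) - 2) / (((n : ℝ) - 1) * ((n : ℝ) - 3)) ≤ 101 / 50 / n := by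
    rw [div_le_div_iff₀ (mul_pos (by linarith) (by linarith)) (by linarith)]
    nlinarith
  have hε90 : (∑ i, ∑ j, |d i j| ^ 3) / (n : ℝ) ≤ 1 / 90 := by
    rw [div_le_iff₀ (by linarith)]
    linarith
  unfold memM1 memM
  generalize 2 * ((n : ℝ) - 2) / (((n : ℝ) - 1) * ((n : ℝ) - 3)) = c at *
  generalize hβ' : ∑ i, ∑ j, |d i j| ^ 3 = β at *
  obtain ⟨ε, hε⟩ : ∃ ε, ε = β / (n : ℝ) := ⟨_, rfl⟩
  rw [← hε] at hε90 ⊢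
  have hε0 : 0 ≤ ε := by rw [hε]; positivity
  obtain ⟨V, hV⟩ : ∃ V, V = c * ∑ i, ∑ j, center (truncHalf d) i j ^ 2 := ⟨_, rfl⟩
  have hV1 : V ≤ 1 := by
    rw [← hvar, hV]
    exact mul_le_mul_of_nonneg_left hle hc0.le
  have hVε : 1 - V ≤ 5 * ε := by
    calc 1 - V = c * (∑ i, ∑ j, d i j ^ 2 - ∑ i, ∑ j, center (truncHalf d) i j ^ 2) := by
          rw [mul_sub, hvar, hV]
      _ ≤ c * (12 / 5 * β) := mul_le_mul_of_nonneg_left hdiff hc0.le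
      _ ≤ 101 / 50 / n * (12 / 5 * β) := by gcongr
      _ = 606 / 125 * ε := by rw [hε]; ring
      _ ≤ _ := by linarith
  obtain ⟨σ, hσ⟩ : ∃ σ, σ = Real.sqrt V := ⟨_, rfl⟩
  have hσ1 : σ ≤ 1 := hσ ▸ Real.sqrt_le_one.2 hV1
  have hσ9 : 9 / 10 ≤ σ := hσ ▸ Real.le_sqrt_of_sq_le (by norm_num; linarith)
  have hσ0 : 0 < σ := by linarith
  have hσV : σ ^ 2 = V := hσ ▸ Real.sq_sqrt (by linarith)
  refine ⟨σ, hσ0, hσ1, ?_, ⟨fun i j => by simp only [center_symm hasym i j],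
    fun i => by simp [center_self], fun i => by rw [← sum_div, sum_center hn3 hadiag, zero_div],
    ?_, ?_⟩, fun i j => ?_⟩
  · rw [div_le_iff₀ hσ0]
    nlinarith
  · simp only [div_pow, ← sum_div]
    rw [← mul_div_assoc, hσV, ← hV]
    exact div_self (by rw [← hσV]; positivity)
  · rw [sum_off_diagonal_eq fun i => by simp [center_self]]
    simp only [abs_div, abs_of_pos hσ0, div_pow, ← sum_div]
    rw [div_le_iff₀ (by positivity)]
    have : (9 / 10 : ℝ) ^ 3 ≤ σ ^ 3 := by gcongr
    nlinarith
  · rw [abs_div, abs_of_pos hσ0, div_le_one hσ0]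
    have := abs_center_le (a := truncHalf d) hn3 i j
    linarith [hw i j, abs_truncHalf_le_half d i j]

end centeredTruncation

/-- `sup{δ_D : D ∈ M_n(γ), β_D/n ≤ 1/90} ≤ δ¹(22γ, n) + 36 γ / n` for even `n ≥ 1000`. -/
theorem delta_le_delta1 (n : ℕ) (hn : Even n) (hn1000 : 1000 ≤ n) (γ : ℝ) (hγ : 0 < γ) :
    ∀ d : Fin n → Fin n → ℝ, memM n γ d →
      (∑ i, ∑ j, if i ≠ j then |d i j| ^ 3 else 0) / n ≤ 1 / 90 →
      deltaArr n d ≤ delta1 (22 * γ) n + 36 * γ / n := by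
  rintro d ⟨hsym, hdiag, hrow, hvar, hβγ⟩ hβn
  have hn3 : 3 ≤ n := by omega
  have hN : (1000 : ℝ) ≤ n := by exact_mod_cast hn1000
  have hN1 : (0 : ℝ) < n - 1 := by linarith
  rw [sum_off_diagonal_eq hdiag] at hβγ hβn
  have hβN : ∑ i, ∑ j, |d i j| ^ 3 ≤ (n : ℝ) / 90 := by
    rw [div_le_iff₀ (by linarith)] at hβn
    linarith
  obtain ⟨σ, hσ0, hσ1, hσε, hE⟩ :=
    exists_memM1_center_truncHalf_div hn1000 hrow hβN hsym hdiag hβγ hvar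
  have hs : |∑ k, ∑ l, truncHalf d k l| ≤ 4 * ∑ i, ∑ j, |d i j| ^ 3 :=
    (abs_sum_le_sum_abs _ _).trans (sum_abs_rowSum_truncHalf_le d hrow)
  have hcard := card_truncHalf_ne_le d
  have hβ0 : 0 ≤ ∑ i, ∑ j, |d i j| ^ 3 := by positivity
  have hdist := abs_cdfYE_sub_le (by omega) d (truncHalf d)
    (fun i => by rw [truncHalf_self hdiag, hdiag])
  generalize ∑ i, ∑ j, |d i j| ^ 3 = β at *
  have hNε : 1 / ((n : ℝ) - 1) ≤ 101 / 100 / n := by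
    rw [div_le_div_iff₀ hN1 (by linarith)]
    linarith
  have hscale : ∀ k : ℝ, 0 ≤ k → k * β / ((n : ℝ) - 1) ≤ k * (101 / 100) * (β / n) := by
    intro k hk
    calc k * β / ((n : ℝ) - 1) = k * β * (1 / (n - 1)) := by ring
      _ ≤ k * β * (101 / 100 / n) := by gcongr
      _ = _ := by ring
  obtain ⟨μ, hμdef⟩ : ∃ μ, μ = (∑ k, ∑ l, truncHalf d k l) / ((n : ℝ) - 1) := ⟨_, rfl⟩
  have hμ : |μ| ≤ 4 * (101 / 100) * (β / n) := by
    rw [hμdef, abs_div, abs_of_pos hN1]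
    exact (div_le_div_of_nonneg_right hs hN1.le).trans (hscale 4 (by norm_num))
  refine ciSup_le fun t => ?_
  have ht : σ * ((t - μ) / σ) + μ = t := by field_simp; ring
  have h1 : |cdfYE n d t - cdfYE n (fun i j => center (truncHalf d) i j / σ) ((t - μ) / σ)| ≤
      8 * (101 / 100) * (β / n) := by
    rw [cdfYE_center_div hn3 _ hσ0, ← hμdef, ht]
    exact (hdist t).trans
      ((div_le_div_of_nonneg_right hcard hN1.le).trans (hscale 8 (by norm_num)))
  have h2 := abs_sub_stdNormalCDF_le_of_affine (μ := μ) hσ0 hσ1 h1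
    ((abs_cdfYE_sub_stdNormalCDF_le_deltaArr n _ _).trans (deltaArr_le_delta1 hE))
  rw [ht] at h2
  have hεγ : β / n ≤ γ / n := by gcongr
  have hε0 : 0 ≤ β / n := by positivity
  rw [mul_div_assoc]
  linarith
end

section
/- Let n ≥ 1000 be even, let D ∈ M_n¹(γ) for some γ > 0 with β_D/n ≤ 1/4500, let T ⊂ {1,…,n} with |T| = l even and l ≤ 8, and let B = (b_{ij}) be the (n−l)×(n−l) array obtained from D by removing the rows and columns indexed by T. Then |μ_B| ≤ 8.07, |σ_B² − 1| ≤ 0.52, and β_B ≤ 50 β_D. -/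
open Finset

/-- A cubic bound for squares, obtained by splitting at `|x| = 1 / 20`. -/
lemma sq_le_add_abs_pow_three (x : ℝ) : x ^ 2 ≤ 1 / 400 + 20 * |x| ^ 3 := by
  rw [← sq_abs]
  have hx := abs_nonneg x
  rcases le_total |x| (1 / 20) with h | h
  · nlinarith [pow_nonneg hx 3]
  · nlinarith [mul_nonneg (sq_nonneg |x|) (sub_nonneg.2 h)]

lemma abs_sum_pow_three_le {ι : Type*} (s : Finset ι) (f : ι → ℝ) :
    |∑ i ∈ s, f i| ^ 3 ≤ (s.card : ℝ) ^ 2 * ∑ i ∈ s, |f i| ^ 3 := by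
  rcases s.eq_empty_or_nonempty with rfl | hs
  · simp
  have hc : (0 : ℝ) < (s.card : ℝ) ^ 2 := by
    have := hs.card_pos
    positivity
  calc |∑ i ∈ s, f i| ^ 3 ≤ (∑ i ∈ s, |f i|) ^ 3 := by
        gcongr
        exact abs_sum_le_sum_abs _ _
    _ ≤ _ := by
        have := pow_sum_div_card_le_sum_pow (s := s) (f := fun i => |f i|)
          (fun i _ => abs_nonneg _) 2
        rw [div_le_iff₀ hc, mul_comm] at this
        exact this

lemma abs_add_four_pow_three_le (a b c e : ℝ) :
    |a - b - c + e| ^ 3 ≤ 16 * (|a| ^ 3 + |b| ^ 3 + |c| ^ 3 + |e| ^ 3) := by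
  have h := abs_sum_pow_three_le (univ : Finset (Fin 4)) ![a, -b, -c, e]
  simp only [Fin.sum_univ_four, card_univ, Fintype.card_fin] at h
  norm_num at h
  simpa [sub_eq_add_neg] using h

lemma sum_sum_le_sum_sum_univ {ι : Type*} [Fintype ι] {f : ι → ι → ℝ} (hf : ∀ i j, 0 ≤ f i j)
    (s t : Finset ι) : ∑ i ∈ s, ∑ j ∈ t, f i j ≤ ∑ i, ∑ j, f i j :=
  (sum_le_sum fun i _ => sum_le_univ_sum_of_nonneg (hf i)).trans
    (sum_le_univ_sum_of_nonneg fun i => sum_nonneg fun j _ => hf i j)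

lemma sum_compl_compl_add_le {ι : Type*} [Fintype ι] [DecidableEq ι] {f : ι → ι → ℝ}
    (hf : ∀ i j, 0 ≤ f i j) (hs : ∀ i j, f i j = f j i) (T : Finset ι) :
    ∑ i, ∑ j, f i j - 2 * ∑ i ∈ T, ∑ j, f i j ≤ ∑ i ∈ Tᶜ, ∑ j ∈ Tᶜ, f i j := by
  have h1 : ∑ i, ∑ j, f i j = ∑ i ∈ T, ∑ j, f i j + ∑ i ∈ Tᶜ, ∑ j, f i j :=
    (sum_add_sum_compl T _).symm
  have h2 : ∑ i ∈ Tᶜ, ∑ j, f i j = ∑ i ∈ Tᶜ, ∑ j ∈ T, f i j + ∑ i ∈ Tᶜ, ∑ j ∈ Tᶜ, f i j := by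
    rw [← sum_add_distrib]
    exact sum_congr rfl fun i _ => (sum_add_sum_compl T _).symm
  have h3 : ∑ i ∈ Tᶜ, ∑ j ∈ T, f i j ≤ ∑ i ∈ T, ∑ j, f i j := by
    rw [sum_comm]
    refine sum_le_sum fun i _ => ?_
    rw [sum_congr rfl fun j _ => hs j i]
    exact sum_le_univ_sum_of_nonneg (hf i)
  linarith

/-- If an `n × n` array has normalised square sum `S` and the removed square sum `R` is small,
the variance functional of the remaining `m × m` array lies close to `1`. -/
lemma variance_bounds {N m S R Q W t : ℝ} (hN : 1000 ≤ N) (hm : N - 8 ≤ m) (hmN : m ≤ N)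
    (hS : 2 * (N - 2) / ((N - 1) * (N - 3)) * S = 1) (hR : R ≤ 49 / 2000 * N)
    (hQ : S - 2 * R ≤ Q) (hQS : Q ≤ S) (hW0 : 0 ≤ W) (hW : W ≤ 8 * R) (ht : |t| ≤ 64) :
    0.64 ≤ 2 / ((m - 1) * (m - 3)) * ((m - 2) * Q + t ^ 2 / (m - 1) - 2 * W) ∧
    2 / ((m - 1) * (m - 3)) * ((m - 2) * Q + t ^ 2 / (m - 1) - 2 * W) ≤ 1.52 := by
  have hS' : 2 * (N - 2) * S = (N - 1) * (N - 3) := by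
    have h1 : N - 1 ≠ 0 := by linarith
    have h3 : N - 3 ≠ 0 := by linarith
    field_simp at hS
    linarith
  have hSu : S ≤ (N - 2) / 2 := by nlinarith
  have hSl : (N - 2) / 2 - 1 / 100 ≤ S := by nlinarith
  have hd : 0 < (m - 1) * (m - 3) := by nlinarith
  have ht2 : t ^ 2 ≤ 4096 := by
    rw [← sq_abs]
    nlinarith [abs_nonneg t]
  have htm0 : 0 ≤ t ^ 2 / (m - 1) := div_nonneg (sq_nonneg t) (by linarith)
  have htm : t ^ 2 / (m - 1) ≤ 5 := by
    rw [div_le_iff₀ (by linarith)]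
    linarith
  rw [div_mul_eq_mul_div, le_div_iff₀ hd, div_le_iff₀ hd]
  have hm2 : 0 ≤ m - 2 := by linarith
  constructor
  · have hq : 9 / 20 * m - 2 ≤ Q := by linarith
    nlinarith [mul_le_mul_of_nonneg_left hq hm2]
  · have hq : Q ≤ (m + 6) / 2 := by linarith
    nlinarith [mul_le_mul_of_nonneg_left hq hm2]

/-- Double centring of an array over a large index set `s` increases the sum of the absolute
third powers by at most a factor close to `16`, provided the row sums and the total sum are
controlled by that sum. -/
lemma sum_abs_centred_pow_three_le {ι : Type*} (s : Finset ι) (d : ι → ι → ℝ) (r : ι → ℝ)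
    {m t β : ℝ} (hsm : (s.card : ℝ) = m) (hm : 992 ≤ m)
    (hβd : ∑ i ∈ s, ∑ j ∈ s, |d i j| ^ 3 ≤ β)
    (hr : ∑ i ∈ s, |r i| ^ 3 ≤ 64 * β) (ht : |t| ^ 3 ≤ 4096 * β) :
    ∑ i ∈ s, ∑ j ∈ s, |d i j - r i / (m - 2) - r j / (m - 2) + t / ((m - 1) * (m - 2))| ^ 3
      ≤ 17 * β := by
  have hm1 : 0 < m - 1 := by linarith
  have hm2 : 0 < m - 2 := by linarith
  have hβ : 0 ≤ β := (sum_nonneg fun i _ => sum_nonneg fun j _ => by positivity).trans hβd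
  set P := ∑ i ∈ s, |r i| ^ 3
  have key : ∑ i ∈ s, ∑ j ∈ s,
      |d i j - r i / (m - 2) - r j / (m - 2) + t / ((m - 1) * (m - 2))| ^ 3 ≤
      16 * (∑ i ∈ s, ∑ j ∈ s, |d i j| ^ 3 + m * (P / (m - 2) ^ 3) + m * (P / (m - 2) ^ 3)
        + m * (m * (|t| ^ 3 / ((m - 1) * (m - 2)) ^ 3))) := by
    refine (sum_le_sum fun i _ => sum_le_sum fun j _ =>
      abs_add_four_pow_three_le _ _ _ _).trans_eq ?_
    simp only [← mul_sum, sum_add_distrib, abs_div, div_pow, abs_mul, abs_of_pos hm1,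
      abs_of_pos hm2, sum_const, nsmul_eq_mul, hsm, ← sum_div, P]
  have hm23 : 900000 * m ≤ (m - 2) ^ 3 := by nlinarith [mul_pos hm2 hm2]
  have h1 : m * (P / (m - 2) ^ 3) ≤ β / 10000 := by
    rw [mul_div_assoc', div_le_iff₀ (by positivity)]
    nlinarith [mul_le_mul_of_nonneg_left hr (by linarith : 0 ≤ m),
      mul_le_mul_of_nonneg_left hm23 hβ]
  have hm6 : 810000000000 * (m * m) ≤ ((m - 1) * (m - 2)) ^ 3 := by
    have h : 900000 * m ≤ (m - 1) ^ 3 :=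
      hm23.trans (pow_le_pow_left₀ hm2.le (by linarith) 3)
    rw [mul_pow]
    calc _ = (900000 * m) * (900000 * m) := by ring
      _ ≤ _ := mul_le_mul h hm23 (by linarith) (by positivity)
  have h2 : m * (m * (|t| ^ 3 / ((m - 1) * (m - 2)) ^ 3)) ≤ β / 10000 := by
    rw [← mul_assoc, mul_div_assoc', div_le_iff₀ (by positivity)]
    nlinarith [mul_le_mul_of_nonneg_left ht (by nlinarith : 0 ≤ m * m),
      mul_le_mul_of_nonneg_left hm6 hβ, mul_nonneg hβ (by nlinarith : 0 ≤ m * m)]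
  linarith

/-- Removing `l ≤ 8` rows and columns (indexed by `T`, `l` even) from `D ∈ M_n¹(γ)` with
`β_D/n ≤ 1/4500` yields an array `B` with `|μ_B| ≤ 8.07`, `|σ_B² − 1| ≤ 0.52` and
`β_B ≤ 50 β_D`. -/
theorem removed_rows_array_properties (n : ℕ) (hn : Even n) (hn1000 : 1000 ≤ n)
    (γ : ℝ) (hγ : 0 < γ)
    (d : Fin n → Fin n → ℝ) (hd : memM1 n γ d)
    (hβDn : (∑ i, ∑ j, if i ≠ j then |d i j| ^ 3 else 0) / n ≤ 1 / 4500)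
    (T : Finset (Fin n)) (hTeven : Even T.card) (hT8 : T.card ≤ 8) :
    let m : ℝ := (n : ℝ) - T.card
    let rowB : Fin n → ℝ := fun i => ∑ j ∈ Tᶜ, d i j
    let colB : Fin n → ℝ := fun j => ∑ i ∈ Tᶜ, d i j
    let totB : ℝ := ∑ i ∈ Tᶜ, rowB i
    let μB : ℝ := totB / (m - 1)
    let σB2 : ℝ := 2 / ((m - 1) * (m - 3)) *
      ((m - 2) * (∑ i ∈ Tᶜ, ∑ j ∈ Tᶜ, d i j ^ 2) + totB ^ 2 / (m - 1)
        - 2 * ∑ i ∈ Tᶜ, rowB i ^ 2)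
    let bhat : Fin n → Fin n → ℝ := fun i j =>
      d i j - rowB i / (m - 2) - colB j / (m - 2) + totB / ((m - 1) * (m - 2))
    let βB : ℝ := (∑ i ∈ Tᶜ, ∑ j ∈ Tᶜ, if i ≠ j then |bhat i j| ^ 3 else 0) /
      Real.sqrt σB2 ^ 3
    |μB| ≤ 8.07 ∧ |σB2 - 1| ≤ 0.52 ∧
      βB ≤ 50 * ∑ i, ∑ j, if i ≠ j then |d i j| ^ 3 else 0 := by
  intro m rowB colB totB μB σB2 bhat βB
  obtain ⟨⟨hsymm, hdiag, hrow, hvar, -⟩, hone⟩ := hd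
  have hN : (1000 : ℝ) ≤ n := by exact_mod_cast hn1000
  have hL : (T.card : ℝ) ≤ 8 := by exact_mod_cast hT8
  have hL0 : (0 : ℝ) ≤ T.card := Nat.cast_nonneg _
  have hL2 : (T.card : ℝ) ^ 2 ≤ 64 := by nlinarith
  have hm : (n : ℝ) - 8 ≤ m := by linarith
  have hmN : m ≤ n := by linarith
  have hcard : ((Tᶜ).card : ℝ) = m := by
    rw [card_compl, Fintype.card_fin, Nat.cast_sub (T.card_le_univ.trans_eq (Fintype.card_fin n))]
  have hβ : (∑ i, ∑ j, if i ≠ j then |d i j| ^ 3 else 0) = ∑ i, ∑ j, |d i j| ^ 3 := by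
    refine sum_congr rfl fun i _ => sum_congr rfl fun j _ => ?_
    split_ifs with h
    · rfl
    · obtain rfl := not_not.1 h
      simp [hdiag i]
  rw [hβ] at hβDn ⊢
  set β := ∑ i, ∑ j, |d i j| ^ 3
  have hcube : ∀ i j, 0 ≤ |d i j| ^ 3 := fun i j => by positivity
  have hβ0 : 0 ≤ β := sum_nonneg fun i _ => sum_nonneg fun j _ => hcube i j
  have hβn : β ≤ n / 4500 := by
    rw [div_le_iff₀ (by linarith)] at hβDn
    linarith
  have hrowB : ∀ i, rowB i = -∑ j ∈ T, d i j := fun i => by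
    have := sum_add_sum_compl T (d i)
    rw [hrow i] at this
    exact eq_neg_of_add_eq_zero_right this
  have hcolB : ∀ j, colB j = rowB j := fun j => sum_congr rfl fun i _ => hsymm i j
  have htotB : totB = ∑ i ∈ T, ∑ j ∈ T, d i j := by
    have h : totB = -∑ j ∈ T, rowB j :=
      calc totB = -∑ i ∈ Tᶜ, ∑ j ∈ T, d i j := by
            rw [← sum_neg_distrib]
            exact sum_congr rfl fun i _ => hrowB i
        _ = -∑ j ∈ T, colB j := by rw [sum_comm]
        _ = -∑ j ∈ T, rowB j := by rw [sum_congr rfl fun j _ => hcolB j]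
    rw [h, sum_congr rfl fun j _ => hrowB j, sum_neg_distrib, neg_neg]
  have htot3 : |totB| ^ 3 ≤ 4096 * β := by
    have h := abs_sum_pow_three_le (T ×ˢ T) fun p => d p.1 p.2
    rw [sum_product, sum_product, ← htotB, card_product] at h
    refine h.trans ?_
    have h4 : (((T.card * T.card : ℕ) : ℝ)) ^ 2 ≤ 4096 := by
      push_cast
      nlinarith
    exact mul_le_mul h4 (sum_sum_le_sum_sum_univ hcube T T)
      (sum_nonneg fun i _ => sum_nonneg fun j _ => hcube i j) (by norm_num)
  have htot : |totB| ≤ 64 := by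
    rw [htotB]
    calc |∑ i ∈ T, ∑ j ∈ T, d i j| ≤ ∑ i ∈ T, ∑ j ∈ T, |d i j| :=
          (abs_sum_le_sum_abs _ _).trans (sum_le_sum fun i _ => abs_sum_le_sum_abs _ _)
      _ ≤ ∑ i ∈ T, ∑ j ∈ T, (1 : ℝ) := sum_le_sum fun i _ => sum_le_sum fun j _ => hone i j
      _ ≤ 64 := by
          simp only [sum_const, nsmul_eq_mul, mul_one]
          linarith
  have hrow3 : ∑ i ∈ Tᶜ, |rowB i| ^ 3 ≤ 64 * β := by
    calc ∑ i ∈ Tᶜ, |rowB i| ^ 3 ≤ ∑ i ∈ Tᶜ, 64 * ∑ j ∈ T, |d i j| ^ 3 := by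
          refine sum_le_sum fun i _ => ?_
          rw [hrowB, abs_neg]
          exact (abs_sum_pow_three_le T (d i)).trans
            (mul_le_mul_of_nonneg_right hL2 (sum_nonneg fun j _ => hcube i j))
      _ ≤ 64 * β := by
          rw [← mul_sum]
          gcongr
          exact sum_sum_le_sum_sum_univ hcube _ _
  set R := ∑ i ∈ T, ∑ j, d i j ^ 2
  have hR : R ≤ 49 / 2000 * n := by
    calc R ≤ ∑ i ∈ T, ∑ j, (1 / 400 + 20 * |d i j| ^ 3) :=
          sum_le_sum fun i _ => sum_le_sum fun j _ => sq_le_add_abs_pow_three _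
      _ = T.card * (n * (1 / 400)) + 20 * ∑ i ∈ T, ∑ j, |d i j| ^ 3 := by
          simp [sum_add_distrib, ← mul_sum]
      _ ≤ 8 * (n * (1 / 400)) + 20 * β := by
          gcongr
          exact sum_sum_le_sum_sum_univ hcube T univ
      _ ≤ _ := by linarith
  have hsq : ∀ i j, 0 ≤ d i j ^ 2 := fun i j => sq_nonneg _
  have hW : ∑ i ∈ Tᶜ, rowB i ^ 2 ≤ 8 * R := by
    calc ∑ i ∈ Tᶜ, rowB i ^ 2 ≤ ∑ i ∈ Tᶜ, 8 * ∑ j ∈ T, d i j ^ 2 := by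
          refine sum_le_sum fun i _ => ?_
          rw [hrowB, neg_sq]
          exact sq_sum_le_card_mul_sum_sq.trans
            (mul_le_mul_of_nonneg_right hL (sum_nonneg fun j _ => hsq i j))
      _ ≤ 8 * R := by
          rw [← mul_sum, sum_comm]
          refine mul_le_mul_of_nonneg_left (sum_le_sum fun j _ => ?_) (by norm_num)
          rw [sum_congr rfl fun i _ => by rw [hsymm i j]]
          exact sum_le_univ_sum_of_nonneg (hsq j)
  obtain ⟨hσl, hσu⟩ := variance_bounds hN hm hmN hvar hR
    (sum_compl_compl_add_le hsq (fun i j => by rw [hsymm]) T)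
    (sum_sum_le_sum_sum_univ hsq _ _) (sum_nonneg fun i _ => sq_nonneg (rowB i)) hW htot
  change 0.64 ≤ σB2 at hσl
  change σB2 ≤ 1.52 at hσu
  refine ⟨?_, abs_le.2 ⟨by linarith, by linarith⟩, ?_⟩
  · rw [abs_div, abs_of_pos (by linarith : 0 < m - 1), div_le_iff₀ (by linarith)]
    linarith
  · have hsqrt : 0.8 ≤ √σB2 := Real.le_sqrt_of_sq_le (by norm_num at hσl ⊢; exact hσl)
    have hcubed : 0.512 ≤ √σB2 ^ 3 :=
      le_trans (by norm_num) (pow_le_pow_left₀ (by norm_num) hsqrt 3)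
    rw [div_le_iff₀ (by linarith)]
    calc (∑ i ∈ Tᶜ, ∑ j ∈ Tᶜ, if i ≠ j then |bhat i j| ^ 3 else 0)
        ≤ ∑ i ∈ Tᶜ, ∑ j ∈ Tᶜ, |bhat i j| ^ 3 := by
          refine sum_le_sum fun i _ => sum_le_sum fun j _ => ?_
          split_ifs
          · rfl
          · positivity
      _ ≤ 17 * β := by
          simp only [bhat, hcolB]
          exact sum_abs_centred_pow_three_le Tᶜ d rowB hcard (by linarith)
            (sum_sum_le_sum_sum_univ hcube _ _) hrow3 htot3
      _ ≤ 50 * β * √σB2 ^ 3 := by nlinarith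
end
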